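/- Let n ≥ 1 and p ≥ 1. For all homogeneous matrices X₁, …, X_{4p+2} ∈ osp(1,2n), the matrix 𝒜_{4p+2}(X₁,…,X_{4p+2}) again belongs to osp(1,2n). -/

import Mathlib

open Matrix

/-- Index type for the ℤ₂-graded space ℂ^p ⊕ ℂ^q. -/
abbrev Idx (p q : ℕ) := Sum (Fin p) (Fin q)

/-- Parity of a basis index. -/
def ipar {p q : ℕ} : Idx p q → ZMod 2
  | Sum.inl _ => 0
  | Sum.inr _ => 1

/-- `(-1)^a` for `a : ZMod 2`. -/
noncomputable def sgn (a : ZMod 2) : ℂ := if a = 1 then -1 else 1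

/-- A matrix is homogeneous of parity `ε` iff it maps the graded piece of
parity `a` into the piece of parity `a + ε`; equivalently, its entry `X i j`
vanishes unless `ipar i = ipar j + ε`. -/
def HasParity {p q : ℕ} (X : Matrix (Idx p q) (Idx p q) ℂ) (ε : ZMod 2) : Prop :=
  ∀ i j, ipar i ≠ ipar j + ε → X i j = 0

/-- A vector is homogeneous of parity `ε`. -/
def VHasParity {p q : ℕ} (u : Idx p q → ℂ) (ε : ZMod 2) : Prop :=
  ∀ i, ipar i ≠ ε → u i = 0

/-- The super sign `ε(σ, 𝒳) = (-1)^{K(σ,𝒳)}`, where `K(σ,𝒳)` is the number of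
pairs `(i,j)` with `i < j`, `σ i > σ j` and both `X (σ i)`, `X (σ j)` odd
(here only the parities `px` of the `X`'s matter). -/
noncomputable def superSign {k : ℕ} (σ : Equiv.Perm (Fin k)) (px : Fin k → ZMod 2) : ℂ :=
  (-1 : ℂ) ^ (Finset.univ.filter (fun ij : Fin k × Fin k =>
      ij.1 < ij.2 ∧ σ ij.2 < σ ij.1 ∧ px (σ ij.1) = 1 ∧ px (σ ij.2) = 1)).card

/-- The ordered matrix product `X (σ 0) * X (σ 1) * ⋯ * X (σ (k-1))`. -/
noncomputable def permProd {k p q : ℕ} (σ : Equiv.Perm (Fin k))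
    (X : Fin k → Matrix (Idx p q) (Idx p q) ℂ) : Matrix (Idx p q) (Idx p q) ℂ :=
  (List.ofFn fun i => X (σ i)).prod

/-- The standard supersymmetric super polynomial `𝒫_k`. -/
noncomputable def symPoly {k p q : ℕ} (X : Fin k → Matrix (Idx p q) (Idx p q) ℂ)
    (px : Fin k → ZMod 2) : Matrix (Idx p q) (Idx p q) ℂ :=
  ∑ σ : Equiv.Perm (Fin k), superSign σ px • permProd σ X

/-- The standard skew supersymmetric super polynomial `𝒜_k`. -/
noncomputable def skewPoly {k p q : ℕ} (X : Fin k → Matrix (Idx p q) (Idx p q) ℂ)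
    (px : Fin k → ZMod 2) : Matrix (Idx p q) (Idx p q) ℂ :=
  ∑ σ : Equiv.Perm (Fin k),
    (((Equiv.Perm.sign σ : ℤ) : ℂ) * superSign σ px) • permProd σ X

/-- The supertrace `str X = tr A - tr D` of a matrix in `gl(p,q)`. -/
noncomputable def strace {p q : ℕ} (X : Matrix (Idx p q) (Idx p q) ℂ) : ℂ :=
  ∑ i : Fin p, X (Sum.inl i) (Sum.inl i) - ∑ j : Fin q, X (Sum.inr j) (Sum.inr j)

/-- The super bracket `[A,B] = AB - (-1)^{|A||B|} BA` of homogeneous matrices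
`A`, `B` of parities `a`, `b`. -/
noncomputable def sbr {p q : ℕ} (A : Matrix (Idx p q) (Idx p q) ℂ) (a : ZMod 2)
    (B : Matrix (Idx p q) (Idx p q) ℂ) (b : ZMod 2) : Matrix (Idx p q) (Idx p q) ℂ :=
  A * B - sgn (a * b) • (B * A)

/-- The matrix of the even bilinear form `B` on `ℂ ⊕ ℂ^{2n}`: it is `1` on the
even line, `0` between the even and odd parts, and the standard symplectic form
with matrix `[[0, Iₙ],[-Iₙ, 0]]` on `ℂ^{2n}`. -/
noncomputable def Bmat (n : ℕ) : Matrix (Idx 1 (2*n)) (Idx 1 (2*n)) ℂ :=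
  fun i j => match i, j with
  | Sum.inl _, Sum.inl _ => 1
  | Sum.inl _, Sum.inr _ => 0
  | Sum.inr _, Sum.inl _ => 0
  | Sum.inr a, Sum.inr b =>
      if a.val + n = b.val then 1 else if b.val + n = a.val then -1 else 0

/-- The bilinear form `B(u,v)` on `ℂ ⊕ ℂ^{2n}`. -/
noncomputable def Bform (n : ℕ) (u v : Idx 1 (2*n) → ℂ) : ℂ :=
  ∑ i, ∑ j, u i * Bmat n i j * v j

/-- `X` is a homogeneous element of `osp(1,2n)` of parity `ε`:
`B(Xu,v) + (-1)^{|X||u|} B(u,Xv) = 0` for all homogeneous `u`, `v`. -/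
def ospMem {n : ℕ} (X : Matrix (Idx 1 (2*n)) (Idx 1 (2*n)) ℂ) (ε : ZMod 2) : Prop :=
  HasParity X ε ∧
  ∀ (u v : Idx 1 (2*n) → ℂ) (εu εv : ZMod 2), VHasParity u εu → VHasParity v εv →
    Bform n (X.mulVec u) v + sgn (ε * εu) * Bform n u (X.mulVec v) = 0

lemma sgn_add (a b : ZMod 2) : sgn (a + b) = sgn a * sgn b := by
  have h : ∀ c : ZMod 2, c = 0 ∨ c = 1 := by decide
  have h2 : (1 + 1 : ZMod 2) = 0 := by decide
  rcases h a with rfl | rfl <;> rcases h b with rfl | rfl <;> simp [sgn, h2]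

lemma sgn_zero : sgn 0 = 1 := by simp [sgn]

lemma sgn_sum {ι : Type*} (s : Finset ι) (f : ι → ZMod 2) :
    sgn (∑ i ∈ s, f i) = ∏ i ∈ s, sgn (f i) := by
  classical
  induction s using Finset.induction_on with
  | empty => simp [sgn_zero]
  | insert i s hi ih => rw [Finset.sum_insert hi, Finset.prod_insert hi, sgn_add, ih]

lemma sgn_mul_self (a : ZMod 2) : sgn a * sgn a = 1 := by
  unfold sgn
  split_ifs <;> norm_num

lemma HasParity.mulVec {p q : ℕ} {X : Matrix (Idx p q) (Idx p q) ℂ} {a b : ZMod 2}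
    {u : Idx p q → ℂ} (hX : HasParity X a) (hu : VHasParity u b) :
    VHasParity (X.mulVec u) (b + a) := by
  intro i hi
  change ∑ j, X i j * u j = 0
  refine Finset.sum_eq_zero fun j _ => ?_
  by_cases hj : ipar j = b
  · rw [hX i j (by rwa [hj]), zero_mul]
  · rw [hu j hj, mul_zero]

lemma HasParity.one {p q : ℕ} : HasParity (1 : Matrix (Idx p q) (Idx p q) ℂ) 0 := by
  intro i j hij
  refine Matrix.one_apply_ne ?_
  rintro rfl
  simp at hij

lemma HasParity.mul {p q : ℕ} {X Y : Matrix (Idx p q) (Idx p q) ℂ} {a b : ZMod 2}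
    (hX : HasParity X a) (hY : HasParity Y b) : HasParity (X * Y) (a + b) := by
  intro i j hij
  rw [Matrix.mul_apply]
  refine Finset.sum_eq_zero fun l _ => ?_
  by_cases hl : ipar l = ipar j + b
  · have h : ipar i ≠ ipar l + a := by
      rwa [hl, add_assoc, add_comm b a]
    rw [hX i l h, zero_mul]
  · rw [hY l j hl, mul_zero]

lemma HasParity.smul {p q : ℕ} {X : Matrix (Idx p q) (Idx p q) ℂ} {a : ZMod 2}
    (hX : HasParity X a) (c : ℂ) : HasParity (c • X) a := by
  intro i j hij
  simp [hX i j hij]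

lemma HasParity.sum {p q : ℕ} {ι : Type*} (s : Finset ι)
    {X : ι → Matrix (Idx p q) (Idx p q) ℂ} {a : ZMod 2} (hX : ∀ x, HasParity (X x) a) :
    HasParity (∑ x ∈ s, X x) a := by
  intro i j hij
  rw [Matrix.sum_apply]
  exact Finset.sum_eq_zero fun x _ => hX x i j hij

lemma HasParity.prod_ofFn {p q k : ℕ} {X : Fin k → Matrix (Idx p q) (Idx p q) ℂ}
    {px : Fin k → ZMod 2} (hX : ∀ i, HasParity (X i) (px i)) :
    HasParity (List.ofFn X).prod (∑ i, px i) := by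
  induction k with
  | zero => simpa using HasParity.one
  | succ k ih =>
    rw [List.ofFn_succ, List.prod_cons, Fin.sum_univ_succ]
    exact (hX 0).mul (ih fun i => hX i.succ)

/-- The product of the signs `(-1)^{f i * f j}` over all pairs `i < j`. -/
noncomputable def pairSign {k : ℕ} (f : Fin k → ZMod 2) : ℂ :=
  ∏ i, ∏ j ∈ Finset.Ioi i, sgn (f i * f j)

lemma pairSign_succ {k : ℕ} (f : Fin (k + 1) → ZMod 2) :
    pairSign f = sgn (f 0 * ∑ i : Fin k, f i.succ) * pairSign fun i : Fin k => f i.succ := by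
  simp only [pairSign, Fin.prod_univ_succ (fun i : Fin (k + 1) => ∏ j ∈ Finset.Ioi i, _),
    Fin.prod_Ioi_zero, Fin.prod_Ioi_succ, Finset.mul_sum, sgn_sum]

lemma Bform_eq_dotProduct {n : ℕ} (u v : Idx 1 (2*n) → ℂ) :
    Bform n u v = u ⬝ᵥ (Bmat n).mulVec v := by
  simp only [Bform, dotProduct, Matrix.mulVec, Finset.mul_sum, mul_assoc]

/-- Reversal of a product of elements of `osp(1,2n)` under passage to the adjoint. -/
lemma Bform_prod_ofFn_mulVec {n k : ℕ} {X : Fin k → Matrix (Idx 1 (2*n)) (Idx 1 (2*n)) ℂ}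
    {px : Fin k → ZMod 2} (hX : ∀ i, ospMem (X i) (px i)) {u v : Idx 1 (2*n) → ℂ}
    {a b : ZMod 2} (hu : VHasParity u a) (hv : VHasParity v b) :
    Bform n ((List.ofFn X).prod.mulVec u) v =
      (-1) ^ k * sgn ((∑ i, px i) * a) * pairSign px *
        Bform n u ((List.ofFn fun i => X i.rev).prod.mulVec v) := by
  induction k generalizing v b with
  | zero => simp [pairSign, sgn_zero]
  | succ k ih =>
    have hw := (HasParity.prod_ofFn fun i : Fin k => (hX i.succ).1).mulVec hu
    have h := (hX 0).2 _ v _ b hw hv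
    rw [ih (fun i => hX i.succ) ((hX 0).1.mulVec hv)] at h
    have hrev : (List.ofFn fun i => X i.rev).prod =
        (List.ofFn fun i : Fin k => X i.rev.succ).prod * X 0 := by
      rw [List.ofFn_succ_last]
      simp [Fin.rev_castSucc]
    rw [List.ofFn_succ, List.prod_cons, ← Matrix.mulVec_mulVec, eq_neg_of_add_eq_zero_left h,
      hrev, ← Matrix.mulVec_mulVec, pairSign_succ, Fin.sum_univ_succ, add_mul, mul_add,
      sgn_add, sgn_add]
    ring

lemma superSign_eq_prod {k : ℕ} (σ : Equiv.Perm (Fin k)) (px : Fin k → ZMod 2) :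
    superSign σ px = ∏ i, ∏ j, if i < j ∧ σ j < σ i then sgn (px (σ i) * px (σ j)) else 1 := by
  rw [superSign, ← Finset.prod_const, Finset.prod_filter, Fintype.prod_prod_type]
  refine Finset.prod_congr rfl fun i _ => Finset.prod_congr rfl fun j _ => ?_
  have h : ∀ a b : ZMod 2, a * b = 1 ↔ a = 1 ∧ b = 1 := by decide
  simp only [sgn, h]
  split_ifs <;> tauto

lemma superSign_mul_revPerm {k : ℕ} (σ : Equiv.Perm (Fin k)) (px : Fin k → ZMod 2) :
    superSign (σ * Fin.revPerm) px =
      ∏ i, ∏ j, if i < j ∧ σ i < σ j then sgn (px (σ i) * px (σ j)) else 1 := by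
  rw [superSign_eq_prod, Finset.prod_comm, ← Equiv.prod_comp Fin.revPerm]
  refine Finset.prod_congr rfl fun i _ => ?_
  rw [← Equiv.prod_comp Fin.revPerm]
  refine Finset.prod_congr rfl fun j _ => ?_
  simp [mul_comm]

lemma superSign_mul_superSign_mul_revPerm {k : ℕ} (σ : Equiv.Perm (Fin k))
    (px : Fin k → ZMod 2) :
    superSign σ px * superSign (σ * Fin.revPerm) px = pairSign fun i => px (σ i) := by
  rw [superSign_mul_revPerm, superSign_eq_prod, pairSign, ← Finset.prod_mul_distrib]
  refine Finset.prod_congr rfl fun i _ => ?_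
  rw [← Finset.prod_mul_distrib, ← Finset.filter_lt_eq_Ioi, Finset.prod_filter]
  refine Finset.prod_congr rfl fun j _ => ?_
  by_cases hij : i < j
  · rcases lt_or_gt_of_ne (σ.injective.ne hij.ne) with h | h <;> simp [hij, h, h.not_gt]
  · simp [hij]

lemma superSign_mul_self {k : ℕ} (σ : Equiv.Perm (Fin k)) (px : Fin k → ZMod 2) :
    superSign σ px * superSign σ px = 1 := by
  rw [superSign, ← mul_pow]
  norm_num

lemma superSign_mul_pairSign {k : ℕ} (σ : Equiv.Perm (Fin k)) (px : Fin k → ZMod 2) :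
    superSign σ px * pairSign (fun i => px (σ i)) = superSign (σ * Fin.revPerm) px := by
  rw [← superSign_mul_superSign_mul_revPerm, ← mul_assoc, superSign_mul_self, one_mul]

lemma sign_revPerm (k : ℕ) :
    Equiv.Perm.sign (Fin.revPerm : Equiv.Perm (Fin k)) = (-1) ^ (k * (k - 1) / 2) := by
  have h : ∀ j : Fin k, ∏ i ∈ Finset.Iio j,
      (if (Fin.revPerm i : Fin k) < Fin.revPerm j then (1 : ℤˣ) else -1) = (-1) ^ (j : ℕ) := by
    intro j
    rw [Finset.prod_congr rfl (g := fun _ => (-1 : ℤˣ)), Finset.prod_const, Fin.card_Iio]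
    intro i hi
    simp [(Finset.mem_Iio.mp hi).not_gt]
  rw [Equiv.Perm.sign_eq_prod_prod_Iio, Finset.prod_congr rfl fun j _ => h j,
    Fin.prod_univ_eq_prod_range (fun j => (-1 : ℤˣ) ^ j), Finset.prod_pow_eq_pow_sum,
    Finset.sum_range_id]

lemma skewPoly_hasParity {p q k : ℕ} {X : Fin k → Matrix (Idx p q) (Idx p q) ℂ}
    {px : Fin k → ZMod 2} (hX : ∀ i, HasParity (X i) (px i)) :
    HasParity (skewPoly X px) (∑ i, px i) := by
  refine HasParity.sum _ fun σ => HasParity.smul ?_ _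
  rw [← Equiv.sum_comp σ px]
  exact HasParity.prod_ofFn fun i => hX (σ i)

lemma Bform_skewPoly_mulVec_left {n k : ℕ} (X : Fin k → Matrix (Idx 1 (2*n)) (Idx 1 (2*n)) ℂ)
    (px : Fin k → ZMod 2) (u v : Idx 1 (2*n) → ℂ) :
    Bform n ((skewPoly X px).mulVec u) v = ∑ σ : Equiv.Perm (Fin k),
      ((Equiv.Perm.sign σ : ℤ) : ℂ) * superSign σ px *
        Bform n ((permProd σ X).mulVec u) v := by
  simp only [Bform_eq_dotProduct, skewPoly, Matrix.sum_mulVec, Matrix.smul_mulVec,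
    sum_dotProduct, smul_dotProduct, smul_eq_mul]

lemma Bform_skewPoly_mulVec_right {n k : ℕ} (X : Fin k → Matrix (Idx 1 (2*n)) (Idx 1 (2*n)) ℂ)
    (px : Fin k → ZMod 2) (u v : Idx 1 (2*n) → ℂ) :
    Bform n u ((skewPoly X px).mulVec v) = ∑ σ : Equiv.Perm (Fin k),
      ((Equiv.Perm.sign σ : ℤ) : ℂ) * superSign σ px *
        Bform n u ((permProd σ X).mulVec v) := by
  simp only [Bform_eq_dotProduct, skewPoly, Matrix.sum_mulVec, Matrix.smul_mulVec,
    Matrix.mulVec_sum, Matrix.mulVec_smul, dotProduct_sum, dotProduct_smul, smul_eq_mul]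

lemma Bform_skewPoly_mulVec {n k : ℕ} {X : Fin k → Matrix (Idx 1 (2*n)) (Idx 1 (2*n)) ℂ}
    {px : Fin k → ZMod 2} (hX : ∀ i, ospMem (X i) (px i)) {u v : Idx 1 (2*n) → ℂ}
    {a b : ZMod 2} (hu : VHasParity u a) (hv : VHasParity v b) :
    Bform n ((skewPoly X px).mulVec u) v =
      (-1) ^ (k + k * (k - 1) / 2) * sgn ((∑ i, px i) * a) *
        Bform n u ((skewPoly X px).mulVec v) := by
  rw [Bform_skewPoly_mulVec_left, Bform_skewPoly_mulVec_right,
    ← Equiv.sum_comp (Equiv.mulRight (Fin.revPerm : Equiv.Perm (Fin k))) (fun σ =>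
      ((Equiv.Perm.sign σ : ℤ) : ℂ) * superSign σ px * Bform n u ((permProd σ X).mulVec v)),
    Finset.mul_sum]
  refine Finset.sum_congr rfl fun σ _ => ?_
  have h := Bform_prod_ofFn_mulVec (fun i => hX (σ i)) hu hv
  rw [Equiv.sum_comp σ px] at h
  have hp : permProd (σ * Fin.revPerm) X = (List.ofFn fun i => X (σ i.rev)).prod := rfl
  have hs : ((-1 : ℂ) ^ (k * (k - 1) / 2)) * (-1) ^ (k * (k - 1) / 2) = 1 := by
    rw [← mul_pow]
    norm_num
  rw [permProd, h, Equiv.coe_mulRight, hp, ← superSign_mul_pairSign, Equiv.Perm.sign_mul,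
    sign_revPerm]
  push_cast
  rw [pow_add]
  linear_combination (-(((Equiv.Perm.sign σ : ℤ) : ℂ) * superSign σ px * (-1) ^ k *
    sgn ((∑ i, px i) * a) * pairSign (fun i => px (σ i)) *
    Bform n u ((List.ofFn fun i => X (σ i.rev)).prod.mulVec v))) * hs

/-- `𝒜_{4p+2}` of homogeneous elements of `osp(1,2n)` again lies in `osp(1,2n)`
(as a homogeneous element of parity `|X₁|+…+|X_{4p+2}|`). -/
theorem skewPoly_mem_osp_two (n p : ℕ) (hn : 1 ≤ n) (hp : 1 ≤ p)
    (X : Fin (4*p+2) → Matrix (Idx 1 (2*n)) (Idx 1 (2*n)) ℂ)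
    (px : Fin (4*p+2) → ZMod 2) (hX : ∀ i, ospMem (X i) (px i)) :
    ospMem (skewPoly X px) (∑ i, px i) := by
  refine ⟨skewPoly_hasParity fun i => (hX i).1, fun u v a b hu hv => ?_⟩
  have hodd : Odd (4 * p + 2 + (4 * p + 2) * (4 * p + 2 - 1) / 2) := by
    have h : (4 * p + 2) * (4 * p + 2 - 1) / 2 = (2 * p + 1) * (4 * p + 1) := by
      refine Nat.div_eq_of_eq_mul_left two_pos ?_
      rw [show 4 * p + 2 - 1 = 4 * p + 1 from rfl]
      ring
    rw [h]
    exact ⟨4 * p ^ 2 + 5 * p + 1, by ring⟩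
  rw [Bform_skewPoly_mulVec hX hu hv, hodd.neg_one_pow]
  ring
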